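/- arXiv:1601.01791 — 2 statements merged into one kernel-verified Lean document; each statement's English description precedes it below -/
import Mathlib

section
/- For every even integer n ≥ 4, the graph G_n contains at least 2^{n-1} distinct covering pairs of disjoint chordless cycles, and in each of these pairs both cycles have length n. -/
/-- The graph `G_n`: vertices are `u_i = (false, i)` and `v_i = (true, i)` for
`i : ZMod n`, with edges `u_i u_{i+1}`, `v_i v_{i+1}`, `u_i v_i` and `v_i u_{i+2}`
(subscripts modulo `n`). -/
def Gn (n : ℕ) : SimpleGraph (Bool × ZMod n) :=
  SimpleGraph.fromRel (fun a b =>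
    (a.1 = false ∧ b.1 = false ∧ b.2 = a.2 + 1) ∨
    (a.1 = true ∧ b.1 = true ∧ b.2 = a.2 + 1) ∨
    (a.1 = false ∧ b.1 = true ∧ b.2 = a.2) ∨
    (a.1 = true ∧ b.1 = false ∧ b.2 = a.2 + 2))

/-- A cycle `C` (given as a closed walk) of a graph `G` is *chordless* if every edge
of `G` joining two vertices of `C` is an edge of `C`. -/
def IsChordless {V : Type*} (G : SimpleGraph V) {u : V} (C : G.Walk u u) : Prop :=
  ∀ a b, G.Adj a b → a ∈ C.support → b ∈ C.support → s(a, b) ∈ C.edges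

/-- Two closed walks are *disjoint* if they share no vertex. -/
def WalkDisjoint {V : Type*} {G : SimpleGraph V} {u v : V}
    (C : G.Walk u u) (C' : G.Walk v v) : Prop :=
  ∀ x, x ∈ C.support → x ∉ C'.support

/-- A pair of closed walks is a *covering pair* if every vertex of the graph lies in
one of them. -/
def CoveringPair {V : Type*} {G : SimpleGraph V} {u v : V}
    (C : G.Walk u u) (C' : G.Walk v v) : Prop :=
  ∀ x : V, x ∈ C.support ∨ x ∈ C'.support

section SequenceWalk

variable {V : Type*} {G : SimpleGraph V}

/-- The walk visiting `x 0, x 1, …, x m` in this order. -/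
def seqWalk (x : ℕ → V) (h : ∀ k, G.Adj (x k) (x (k + 1))) : (m : ℕ) → G.Walk (x 0) (x m)
  | 0 => SimpleGraph.Walk.nil
  | m + 1 => (seqWalk x h m).concat (h m)

variable (x : ℕ → V) (h : ∀ k, G.Adj (x k) (x (k + 1)))

theorem length_seqWalk (m : ℕ) : (seqWalk x h m).length = m := by
  induction m with
  | zero => rfl
  | succ m ih => simp [seqWalk, ih]

theorem support_seqWalk (m : ℕ) :
    (seqWalk x h m).support = (List.range (m + 1)).map x := by
  induction m with
  | zero => rfl
  | succ m ih =>
    rw [seqWalk, SimpleGraph.Walk.support_concat, ih, List.range_succ (n := m + 1)]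
    simp

theorem edges_seqWalk (m : ℕ) :
    (seqWalk x h m).edges = (List.range m).map fun k => s(x k, x (k + 1)) := by
  induction m with
  | zero => rfl
  | succ m ih =>
    rw [seqWalk, SimpleGraph.Walk.edges_concat, ih, List.range_succ]
    simp

theorem isCycle_cons_seqWalk {m : ℕ} (hm : 2 ≤ m) (hinj : Set.InjOn x (Set.Iic m))
    (hadj : G.Adj (x m) (x 0)) :
    (SimpleGraph.Walk.cons hadj (seqWalk x h m)).IsCycle := by
  rw [SimpleGraph.Walk.cons_isCycle_iff]
  constructor
  · rw [SimpleGraph.Walk.isPath_def, support_seqWalk]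
    refine List.Nodup.map_on (fun a ha b hb hab => hinj ?_ ?_ hab) List.nodup_range
    · simp at ha ⊢; omega
    · simp at hb ⊢; omega
  · rw [edges_seqWalk]
    intro hmem
    obtain ⟨k, hk, hke⟩ := List.mem_map.1 hmem
    rw [List.mem_range] at hk
    rcases Sym2.eq_iff.1 hke with ⟨h1, -⟩ | ⟨h1, h2⟩
    · have := hinj (by simp; omega) (by simp) h1
      omega
    · have h3 := hinj (by simp; omega) (by simp) h1
      have h4 := hinj (by simp; omega) (by simp) h2
      omega

end SequenceWalk

/-- The position of a vertex of `G_n` around the graph: `u_i` and `v_{i-1}` are at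
position `i`, and adjacency means having consecutive positions. -/
def GnPos {n : ℕ} (a : Bool × ZMod n) : ZMod n := if a.1 then a.2 + 1 else a.2

/-- The vertex at position `i` selected by `f`: it is `v_{i-1}` if `f i` holds, and `u_i`
otherwise. -/
def GnVertex {n : ℕ} (f : ZMod n → Bool) (i : ZMod n) : Bool × ZMod n :=
  (f i, if f i then i - 1 else i)

theorem Gn_adj_iff {n : ℕ} (hn : 2 ≤ n) (a b : Bool × ZMod n) :
    (Gn n).Adj a b ↔ GnPos b = GnPos a + 1 ∨ GnPos a = GnPos b + 1 := by
  have : Fact (1 < n) := ⟨hn⟩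
  have h10 : (1 : ZMod n) ≠ 0 := one_ne_zero
  obtain ⟨p, i⟩ := a
  obtain ⟨q, j⟩ := b
  rw [Gn, SimpleGraph.fromRel_adj]
  cases p <;> cases q <;> simp only [GnPos, ne_eq, Prod.mk.injEq] <;> grind

@[simp]
theorem GnPos_GnVertex {n : ℕ} (f : ZMod n → Bool) (i : ZMod n) :
    GnPos (GnVertex f i) = i := by
  unfold GnPos GnVertex
  cases f i <;> simp

theorem GnVertex_GnPos {n : ℕ} {f : ZMod n → Bool} {a : Bool × ZMod n}
    (h : f (GnPos a) = a.1) : GnVertex f (GnPos a) = a := by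
  obtain ⟨p, i⟩ := a
  unfold GnVertex
  rw [h]
  cases p <;> simp [GnPos]

theorem mem_range_GnVertex {n : ℕ} {f : ZMod n → Bool} {a : Bool × ZMod n} :
    a ∈ Set.range (GnVertex f) ↔ f (GnPos a) = a.1 := by
  constructor
  · rintro ⟨i, rfl⟩
    rw [GnPos_GnVertex]
    rfl
  · exact fun h => ⟨_, GnVertex_GnPos h⟩

/-- The edges joining consecutive vertices selected by `f`. -/
def GnEdges {n : ℕ} (f : ZMod n → Bool) : Set (Sym2 (Bool × ZMod n)) :=
  Set.range fun i => s(GnVertex f i, GnVertex f (i + 1))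

theorem GnEdges_injective {n : ℕ} :
    Function.Injective (GnEdges : (ZMod n → Bool) → Set (Sym2 (Bool × ZMod n))) := by
  intro f g h
  funext i
  have hi : s(GnVertex f i, GnVertex f (i + 1)) ∈ GnEdges g := h ▸ ⟨i, rfl⟩
  obtain ⟨j, hj⟩ := hi
  have hmem : GnVertex f i ∈ Set.range (GnVertex g) := by
    rcases Sym2.eq_iff.1 hj with ⟨h1, -⟩ | ⟨-, h1⟩
    · exact ⟨_, h1⟩
    · exact ⟨_, h1⟩
  rw [mem_range_GnVertex, GnPos_GnVertex] at hmem
  exact hmem.symm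

/-- Selecting one vertex at each position yields a cycle of `G_n` of length `n`. -/
theorem exists_isCycle_of_selection {n : ℕ} (hn : 3 ≤ n) (f : ZMod n → Bool) :
    ∃ (u : Bool × ZMod n) (C : (Gn n).Walk u u), C.IsCycle ∧ C.length = n ∧
      (∀ a, a ∈ C.support ↔ f (GnPos a) = a.1) ∧ {e | e ∈ C.edges} = GnEdges f := by
  obtain ⟨m, rfl⟩ : ∃ m, n = m + 1 := ⟨n - 1, by omega⟩
  have hadj (i j : ZMod (m + 1)) (hij : j = i + 1) :
      (Gn (m + 1)).Adj (GnVertex f i) (GnVertex f j) := by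
    rw [Gn_adj_iff (by omega)]
    simp [hij]
  have hlast : (0 : ZMod (m + 1)) = (m : ZMod (m + 1)) + 1 := by
    exact_mod_cast (ZMod.natCast_self (m + 1)).symm
  have hval (i : ZMod (m + 1)) : ∃ k < m + 1, (k : ZMod (m + 1)) = i :=
    ⟨i.val, i.val_lt, ZMod.natCast_zmod_val i⟩
  let x : ℕ → Bool × ZMod (m + 1) := fun k => GnVertex f k
  have hx (k : ℕ) : (Gn (m + 1)).Adj (x k) (x (k + 1)) := hadj _ _ (by push_cast; rfl)
  have hclose : (Gn (m + 1)).Adj (x m) (x 0) := hadj _ _ (by simp [← hlast])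
  refine ⟨x m, .cons hclose (seqWalk x hx m), isCycle_cons_seqWalk x hx (by omega) ?_ hclose,
    ?_, fun a => ?_, ?_⟩
  · intro a ha b hb hab
    have h := congrArg GnPos hab
    simp only [x, GnPos_GnVertex] at h
    rw [ZMod.natCast_eq_natCast_iff'] at h
    simp only [Set.mem_Iic] at ha hb
    rwa [Nat.mod_eq_of_lt (by omega), Nat.mod_eq_of_lt (by omega)] at h
  · simp [length_seqWalk]
  · rw [← mem_range_GnVertex, SimpleGraph.Walk.support_cons, support_seqWalk, List.mem_cons,
      List.mem_map]
    constructor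
    · rintro (rfl | ⟨k, -, rfl⟩) <;> exact ⟨_, rfl⟩
    · rintro ⟨i, rfl⟩
      obtain ⟨k, hk, rfl⟩ := hval i
      exact Or.inr ⟨k, List.mem_range.2 hk, rfl⟩
  · ext e
    rw [Set.mem_ofPred_eq, SimpleGraph.Walk.edges_cons, edges_seqWalk, List.mem_cons,
      List.mem_map]
    constructor
    · rintro (rfl | ⟨k, -, rfl⟩)
      · exact ⟨(m : ZMod (m + 1)), by simp [x, ← hlast]⟩
      · exact ⟨(k : ZMod (m + 1)), by simp [x]⟩
    · rintro ⟨i, rfl⟩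
      obtain ⟨k, hk, rfl⟩ := hval i
      rcases Nat.lt_succ_iff_lt_or_eq.1 hk with hk | rfl
      · exact Or.inr ⟨k, List.mem_range.2 hk, by simp [x]⟩
      · exact Or.inl (by simp [x, ← hlast])

theorem isChordless_of_selection {n : ℕ} (hn : 2 ≤ n) {f : ZMod n → Bool} {u : Bool × ZMod n}
    {C : (Gn n).Walk u u} (hsupp : ∀ a, a ∈ C.support ↔ f (GnPos a) = a.1)
    (hedges : {e | e ∈ C.edges} = GnEdges f) : IsChordless (Gn n) C := by
  intro a b hab ha hb
  have ha' := GnVertex_GnPos ((hsupp a).1 ha)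
  have hb' := GnVertex_GnPos ((hsupp b).1 hb)
  change s(a, b) ∈ {e | e ∈ C.edges}
  rw [hedges]
  rcases (Gn_adj_iff hn a b).1 hab with h | h
  · refine ⟨GnPos a, ?_⟩
    dsimp only
    rw [← h, ha', hb']
  · refine ⟨GnPos b, ?_⟩
    dsimp only
    rw [← h, ha', hb', Sym2.eq_swap]

/-- For every even `n ≥ 4`, the graph `G_n` has at least `2 ^ (n - 1)` distinct
covering pairs of disjoint chordless cycles, in each of which both cycles have
length `n`. Pairs are recorded as unordered pairs of cycle edge sets. -/
theorem Gn_many_covering_pairs (n : ℕ) (hn : 4 ≤ n) (heven : Even n) :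
    2 ^ (n - 1) ≤
      Set.ncard {p : Sym2 (Set (Sym2 (Bool × ZMod n))) |
        ∃ (u v : Bool × ZMod n) (C : (Gn n).Walk u u) (C' : (Gn n).Walk v v),
          C.IsCycle ∧ C'.IsCycle ∧ IsChordless (Gn n) C ∧ IsChordless (Gn n) C' ∧
          WalkDisjoint C C' ∧ CoveringPair C C' ∧
          C.length = n ∧ C'.length = n ∧
          p = s({e | e ∈ C.edges}, {e | e ∈ C'.edges})} := by
  obtain ⟨m, rfl⟩ : ∃ m, n = m + 1 := ⟨n - 1, by omega⟩
  let sel : (Fin m → Bool) → ZMod (m + 1) → Bool := fun h => Fin.cons (α := fun _ => Bool) false h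
  let pair : (Fin m → Bool) → Sym2 (Set (Sym2 (Bool × ZMod (m + 1)))) :=
    fun h => s(GnEdges (sel h), GnEdges fun i => !sel h i)
  have hsel : Function.Injective sel := Fin.cons_right_injective (α := fun _ => Bool) false
  have hsel_zero (h : Fin m → Bool) : sel h 0 = false := rfl
  have hpair : Function.Injective pair := by
    intro h h' heq
    rcases Sym2.eq_iff.1 heq with ⟨h1, -⟩ | ⟨h1, -⟩
    · exact hsel (GnEdges_injective h1)
    · have h0 := congrFun (GnEdges_injective h1) 0
      simp [hsel_zero] at h0
  calc 2 ^ (m + 1 - 1) = (Set.range pair).ncard := by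
        rw [← Set.image_univ, Set.ncard_image_of_injective _ hpair, Set.ncard_univ]
        simp
    _ ≤ _ := by
        refine Set.ncard_le_ncard ?_ (Set.toFinite _)
        rintro _ ⟨h, rfl⟩
        obtain ⟨u, C, hC, hlen, hsupp, hedges⟩ :=
          exists_isCycle_of_selection (by omega) (sel h)
        obtain ⟨v, C', hC', hlen', hsupp', hedges'⟩ :=
          exists_isCycle_of_selection (by omega) (fun i => !sel h i)
        refine ⟨u, v, C, C', hC, hC', isChordless_of_selection (by omega) hsupp hedges,
          isChordless_of_selection (by omega) hsupp' hedges', fun a ha ha' => ?_, fun a => ?_,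
          hlen, hlen', by rw [hedges, hedges']⟩
        · rw [hsupp] at ha
          rw [hsupp', ha] at ha'
          simp at ha'
        · rw [hsupp, hsupp']
          cases sel h (GnPos a) <;> cases a.1 <;> simp
end

section
/- For every even integer n ≥ 4, the graph G_n is a connected 4-regular simple graph with 2n vertices and 4n edges, and each of the four cycles C_1 = u_1 u_2 … u_n u_1, C_2 = v_1 v_2 … v_n v_1, C_3 = u_1 v_1 u_3 v_3 … u_{n-1} v_{n-1} u_1 and C_4 = u_2 v_2 u_4 v_4 … u_n v_n u_2 is a chordless cycle of G_n, with {C_1, C_2} and {C_3, C_4} each forming a covering pair of disjoint chordless cycles. -/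
/-- The edge set of the cycle `C_1 = u_1 u_2 ⋯ u_n u_1`. -/
def edges1 (n : ℕ) : Set (Sym2 (Bool × ZMod n)) :=
  {e | ∃ i : ZMod n, e = s((false, i), (false, i + 1))}

/-- The edge set of the cycle `C_2 = v_1 v_2 ⋯ v_n v_1`. -/
def edges2 (n : ℕ) : Set (Sym2 (Bool × ZMod n)) :=
  {e | ∃ i : ZMod n, e = s((true, i), (true, i + 1))}

/-- The edge set of the cycle `C_3 = u_1 v_1 u_3 v_3 ⋯ u_{n-1} v_{n-1} u_1`:
the edges `u_i v_i` and `v_i u_{i+2}` over odd indices `i`. -/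
def edges3 (n : ℕ) : Set (Sym2 (Bool × ZMod n)) :=
  {e | ∃ i : ZMod n, Odd i.val ∧
    (e = s((false, i), (true, i)) ∨ e = s((true, i), (false, i + 2)))}

/-- The edge set of the cycle `C_4 = u_2 v_2 u_4 v_4 ⋯ u_n v_n u_2`:
the edges `u_i v_i` and `v_i u_{i+2}` over even indices `i`. -/
def edges4 (n : ℕ) : Set (Sym2 (Bool × ZMod n)) :=
  {e | ∃ i : ZMod n, Even i.val ∧
    (e = s((false, i), (true, i)) ∨ e = s((true, i), (false, i + 2)))}

namespace SimpleGraph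

/-- Consecutively adjacent vertices `g 0, g 1, …, g k` form a walk. -/
theorem exists_walk_of_adj_succ {V : Type*} (G : SimpleGraph V) (g : ℕ → V)
    (hadj : ∀ i, G.Adj (g i) (g (i + 1))) (k : ℕ) :
    ∃ p : G.Walk (g 0) (g k), p.support = (List.range (k + 1)).map g ∧
      p.edges = (List.range k).map fun i => s(g i, g (i + 1)) := by
  induction k with
  | zero => exact ⟨Walk.nil, by simp, by simp⟩
  | succ k ih =>
    obtain ⟨p, hs, he⟩ := ih
    refine ⟨p.concat (hadj k), ?_, ?_⟩
    · rw [Walk.support_concat, hs, List.range_succ (n := k + 1)]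
      simp
    · rw [Walk.edges_concat, he, List.range_succ]
      simp

/-- A sequence of consecutively adjacent vertices that first returns to its start after
`m ≥ 3` steps traces a cycle. -/
theorem exists_isCycle_of_adj_succ {V : Type*} (G : SimpleGraph V) (g : ℕ → V) {m : ℕ}
    (hm : 3 ≤ m) (hadj : ∀ i, G.Adj (g i) (g (i + 1))) (hper : g m = g 0)
    (hinj : ∀ i < m, ∀ j < m, g i = g j → i = j) :
    ∃ C : G.Walk (g 0) (g 0), C.IsCycle ∧
      (∀ x, x ∈ C.support ↔ ∃ i < m, g i = x) ∧
      ∀ e, e ∈ C.edges ↔ ∃ i < m, e = s(g i, g (i + 1)) := by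
  obtain ⟨k, rfl⟩ : ∃ k, m = k + 1 := ⟨m - 1, by omega⟩
  have hp : ∃ p : G.Walk (g 1) (g 0),
      p.support = (List.range (k + 1)).map (fun i => g (i + 1)) ∧
      p.edges = (List.range k).map fun i => s(g (i + 1), g (i + 1 + 1)) := by
    rw [← hper]
    exact G.exists_walk_of_adj_succ (fun i => g (i + 1)) (fun i => hadj (i + 1)) k
  obtain ⟨p, hs, he⟩ := hp
  refine ⟨Walk.cons (hadj 0) p, ?_, ?_, ?_⟩
  · rw [Walk.cons_isCycle_iff, Walk.isPath_def, hs, he]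
    constructor
    · refine List.Nodup.map_on ?_ List.nodup_range
      intro i hi j hj hij
      rw [List.mem_range] at hi hj
      by_cases h1 : i = k <;> by_cases h2 : j = k
      · omega
      · subst h1
        rw [hper] at hij
        have := hinj 0 (by omega) (j + 1) (by omega) hij
        omega
      · subst h2
        rw [hper] at hij
        have := hinj (i + 1) (by omega) 0 (by omega) hij
        omega
      · have := hinj (i + 1) (by omega) (j + 1) (by omega) hij
        omega
    · intro h
      rw [List.mem_map] at h
      obtain ⟨i, hi, h⟩ := h
      rw [List.mem_range] at hi
      rw [Sym2.eq_iff] at h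
      rcases h with ⟨h, -⟩ | ⟨h, h'⟩
      · have := hinj (i + 1) (by omega) 0 (by omega) h
        omega
      · have := hinj (i + 1) (by omega) (0 + 1) (by omega) h
        obtain rfl : i = 0 := by omega
        have := hinj (0 + 1 + 1) (by omega) 0 (by omega) h'
        omega
  · intro x
    rw [Walk.support_cons, hs, List.mem_cons, List.mem_map]
    constructor
    · rintro (rfl | ⟨i, hi, rfl⟩)
      · exact ⟨0, by omega, rfl⟩
      · rw [List.mem_range] at hi
        by_cases h : i = k
        · exact ⟨0, by omega, by rw [h, hper]⟩
        · exact ⟨i + 1, by omega, rfl⟩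
    · rintro ⟨_ | i, hi, rfl⟩
      · exact Or.inl rfl
      · exact Or.inr ⟨i, by rw [List.mem_range]; omega, rfl⟩
  · intro e
    rw [Walk.edges_cons, he, List.mem_cons, List.mem_map]
    constructor
    · rintro (rfl | ⟨i, hi, rfl⟩)
      · exact ⟨0, by omega, rfl⟩
      · rw [List.mem_range] at hi
        exact ⟨i + 1, by omega, rfl⟩
    · rintro ⟨_ | i, hi, rfl⟩
      · exact Or.inl rfl
      · exact Or.inr ⟨i, by rw [List.mem_range]; omega, rfl⟩

end SimpleGraph

namespace ZMod

theorem natCast_ne_zero_of_lt {n a : ℕ} (h0 : 0 < a) (h : a < n) : (a : ZMod n) ≠ 0 := by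
  rw [Ne, ZMod.natCast_eq_zero_iff]
  exact Nat.not_dvd_of_pos_of_lt h0 h

theorem natCast_inj_of_lt {n i j : ℕ} (hi : i < n) (hj : j < n)
    (h : (i : ZMod n) = j) : i = j := by
  rwa [ZMod.natCast_eq_natCast_iff', Nat.mod_eq_of_lt hi, Nat.mod_eq_of_lt hj] at h

/-- For even `n`, reduction modulo `n` preserves parity. -/
theorem val_natCast_mod_two {n : ℕ} (heven : Even n) (a : ℕ) :
    (a : ZMod n).val % 2 = a % 2 := by
  rw [ZMod.val_natCast, Nat.mod_mod_of_dvd _ heven.two_dvd]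

theorem val_add_natCast_mod_two {n : ℕ} [NeZero n] (heven : Even n) (i : ZMod n) (a : ℕ) :
    (i + a).val % 2 = (i.val + a) % 2 := by
  rw [← val_natCast_mod_two heven (i.val + a), Nat.cast_add, natCast_zmod_val]

end ZMod

namespace Gn

variable {n : ℕ}

theorem adj_same_iff (hn : 2 ≤ n) (b : Bool) (i j : ZMod n) :
    (Gn n).Adj (b, i) (b, j) ↔ j = i + 1 ∨ i = j + 1 := by
  have h1 : (1 : ZMod n) ≠ 0 := by
    exact_mod_cast ZMod.natCast_ne_zero_of_lt (n := n) (a := 1) (by omega) (by omega)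
  have h : ∀ i : ZMod n, i ≠ i + 1 := fun i h => h1 (by simpa using h)
  cases b <;> simp only [Gn, SimpleGraph.fromRel_adj, ne_eq, Prod.mk.injEq, true_and, reduceCtorEq,
    false_and, or_false, false_or, and_iff_right_iff_imp] <;>
  · rintro (rfl | rfl) h'
    · exact h _ h'
    · exact h _ h'.symm

theorem adj_false_true_iff (i j : ZMod n) :
    (Gn n).Adj (false, i) (true, j) ↔ j = i ∨ i = j + 2 := by
  simp [Gn, SimpleGraph.fromRel_adj]

theorem adj_true_false_iff (i j : ZMod n) :
    (Gn n).Adj (true, i) (false, j) ↔ j = i + 2 ∨ i = j := by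
  rw [SimpleGraph.adj_comm, adj_false_true_iff]
  tauto

theorem neighborSet_false (hn : 2 ≤ n) (i : ZMod n) :
    (Gn n).neighborSet (false, i) =
      {(false, i + 1), (false, i - 1), (true, i), (true, i - 2)} := by
  ext ⟨b, j⟩
  cases b
  · simp [adj_same_iff hn, eq_sub_iff_add_eq, eq_comm]
  · simp [adj_false_true_iff, eq_sub_iff_add_eq, eq_comm]

theorem neighborSet_true (hn : 2 ≤ n) (i : ZMod n) :
    (Gn n).neighborSet (true, i) =
      {(true, i + 1), (true, i - 1), (false, i), (false, i + 2)} := by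
  ext ⟨b, j⟩
  cases b
  · simp [adj_true_false_iff, eq_comm, or_comm]
  · simp [adj_same_iff hn, eq_sub_iff_add_eq, eq_comm]

theorem ncard_neighborSet (hn : 3 ≤ n) (w : Bool × ZMod n) :
    ((Gn n).neighborSet w).ncard = 4 := by
  have h2 : (2 : ZMod n) ≠ 0 := by
    exact_mod_cast ZMod.natCast_ne_zero_of_lt (n := n) (a := 2) (by omega) (by omega)
  obtain ⟨b, i⟩ := w
  have hpm : i + 1 ≠ i - 1 := fun h => h2 (by linear_combination h)
  cases b
  · rw [neighborSet_false (by omega)]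
    have : i ≠ i - 2 := fun h => h2 (by linear_combination h)
    rw [Set.ncard_insert_of_notMem, Set.ncard_insert_of_notMem, Set.ncard_pair] <;> simp [*]
  · rw [neighborSet_true (by omega)]
    rw [Set.ncard_insert_of_notMem, Set.ncard_insert_of_notMem, Set.ncard_pair] <;> simp [*]

theorem ncard_edgeSet (hn : 3 ≤ n) : ((Gn n).edgeSet).ncard = 4 * n := by
  classical
  have : NeZero n := ⟨by omega⟩
  have h := (Gn n).sum_degrees_eq_twice_card_edges
  have hd : ∀ w, (Gn n).degree w = 4 := fun w => by
    rw [← ncard_neighborSet hn w, Set.ncard_eq_toFinset_card',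
      ← SimpleGraph.card_neighborFinset_eq_degree]
    rfl
  simp only [hd, Finset.sum_const, Finset.card_univ, Fintype.card_prod, Fintype.card_bool,
    ZMod.card, smul_eq_mul] at h
  rw [← SimpleGraph.coe_edgeFinset, Set.ncard_coe_finset]
  omega

theorem connected (hn : 2 ≤ n) : (Gn n).Connected := by
  have : NeZero n := ⟨by omega⟩
  have hu : ∀ k : ℕ, (Gn n).Reachable (false, 0) (false, (k : ZMod n)) := by
    intro k
    induction k with
    | zero => simp
    | succ k ih =>
      refine ih.trans (SimpleGraph.Adj.reachable ?_)
      rw [adj_same_iff hn]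
      simp
  have hu' : ∀ i : ZMod n, (Gn n).Reachable (false, 0) (false, i) := fun i => by
    rw [← ZMod.natCast_zmod_val i]
    exact hu _
  have h : ∀ w, (Gn n).Reachable (false, 0) w := by
    rintro ⟨_ | _, i⟩
    · exact hu' i
    · exact (hu' i).trans (SimpleGraph.Adj.reachable ((adj_false_true_iff i i).2 (Or.inl rfl)))
  exact { preconnected := fun v w => (h v).symm.trans (h w), nonempty := ⟨(false, 0)⟩ }

/-- Each of the two layers of `Gn n` is the vertex set of a cycle. -/
theorem exists_layer_cycle (hn : 3 ≤ n) (b : Bool) :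
    ∃ C : (Gn n).Walk (b, 0) (b, 0), C.IsCycle ∧ (∀ x, x ∈ C.support ↔ x.1 = b) ∧
      {e | e ∈ C.edges} = {e | ∃ i : ZMod n, e = s((b, i), (b, i + 1))} := by
  have : NeZero n := ⟨by omega⟩
  obtain ⟨C, hC, hs, he⟩ := (Gn n).exists_isCycle_of_adj_succ
    (fun i => (b, (i : ZMod n))) hn
    (fun i => by simp [adj_same_iff (show 2 ≤ n by omega)]) (by simp)
    (fun i hi j hj h => ZMod.natCast_inj_of_lt hi hj (congrArg Prod.snd h))
  rw [show ((b, 0) : Bool × ZMod n) = (b, ((0 : ℕ) : ZMod n)) by simp]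
  refine ⟨C, hC, fun x => ?_, Set.ext fun e => ?_⟩
  · rw [hs]
    constructor
    · rintro ⟨i, -, rfl⟩
      rfl
    · rintro rfl
      exact ⟨x.2.val, ZMod.val_lt _, by simp⟩
  · rw [Set.mem_ofPred_eq, he, Set.mem_ofPred_eq]
    constructor
    · rintro ⟨i, -, rfl⟩
      exact ⟨i, by simp⟩
    · rintro ⟨i, rfl⟩
      exact ⟨i.val, ZMod.val_lt _, by simp⟩

theorem isChordless_of_layer (hn : 2 ≤ n) {b : Bool} {a : Bool × ZMod n}
    {C : (Gn n).Walk a a} (hs : ∀ x, x ∈ C.support ↔ x.1 = b)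
    (he : {e | e ∈ C.edges} = {e | ∃ i : ZMod n, e = s((b, i), (b, i + 1))}) :
    IsChordless (Gn n) C := by
  rintro ⟨c, i⟩ ⟨d, j⟩ hadj hi hj
  obtain rfl : c = b := (hs _).1 hi
  obtain rfl : d = c := (hs _).1 hj
  change _ ∈ {e | e ∈ C.edges}
  rw [he]
  rcases (adj_same_iff hn d i j).1 hadj with rfl | rfl
  · exact ⟨i, rfl⟩
  · exact ⟨j, Sym2.eq_swap⟩

/-- The sequence `u_p, v_p, u_{p+2}, v_{p+2}, …`. -/
def zigzag (n p : ℕ) (k : ℕ) : Bool × ZMod n :=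
  (decide (k % 2 = 1), ((p + 2 * (k / 2) : ℕ) : ZMod n))

theorem zigzag_two_mul (p t : ℕ) :
    zigzag n p (2 * t) = (false, ((p + 2 * t : ℕ) : ZMod n)) := by
  simp [zigzag]

theorem zigzag_two_mul_add_one (p t : ℕ) :
    zigzag n p (2 * t + 1) = (true, ((p + 2 * t : ℕ) : ZMod n)) := by
  simp [zigzag, Nat.mul_add_div]

theorem zigzag_two_mul_add_two (p t : ℕ) :
    zigzag n p (2 * t + 1 + 1) = (false, ((p + 2 * t : ℕ) : ZMod n) + 2) := by
  rw [show 2 * t + 1 + 1 = 2 * (t + 1) by ring, zigzag_two_mul]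
  push_cast
  ring_nf

theorem adj_zigzag (p k : ℕ) : (Gn n).Adj (zigzag n p k) (zigzag n p (k + 1)) := by
  obtain ⟨t, rfl | rfl⟩ := Nat.even_or_odd' k
  · rw [zigzag_two_mul, zigzag_two_mul_add_one, adj_false_true_iff]
    exact Or.inl rfl
  · rw [zigzag_two_mul_add_one, zigzag_two_mul_add_two, adj_true_false_iff]
    exact Or.inl rfl

theorem zigzag_self (heven : Even n) (p : ℕ) : zigzag n p n = zigzag n p 0 := by
  obtain ⟨t, rfl⟩ := heven.two_dvd
  rw [zigzag_two_mul, Nat.cast_add, ZMod.natCast_self]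
  simp [zigzag]

theorem zigzag_inj {p i j : ℕ} (hi : i < n) (hj : j < n) (h : zigzag n p i = zigzag n p j) :
    i = j := by
  simp only [zigzag, Prod.mk.injEq, decide_eq_decide, Nat.cast_add p, add_right_inj] at h
  have := ZMod.natCast_inj_of_lt (by omega) (by omega) h.2
  have := h.1
  omega

/-- Every index of the same parity as `p` is reached by the zigzag starting at `p`. -/
theorem exists_eq_natCast_add_two_mul [NeZero n] (heven : Even n) {p : ℕ} (hp : p < 2)
    (i : ZMod n) (hi : i.val % 2 = p) : ∃ t, 2 * t + 1 < n ∧ i = ((p + 2 * t : ℕ) : ZMod n) := by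
  refine ⟨i.val / 2, ?_, ?_⟩
  · have := ZMod.val_lt i
    obtain ⟨m, rfl⟩ := heven.two_dvd
    omega
  · rw [show p + 2 * (i.val / 2) = i.val by omega, ZMod.natCast_zmod_val]

/-- The vertices whose index has a prescribed parity form a cycle of `Gn n`. -/
theorem exists_parity_cycle (hn : 3 ≤ n) (heven : Even n) {p : ℕ} (hp : p < 2) :
    ∃ C : (Gn n).Walk (zigzag n p 0) (zigzag n p 0),
      C.IsCycle ∧ (∀ x, x ∈ C.support ↔ x.2.val % 2 = p) ∧
      {e | e ∈ C.edges} = {e | ∃ i : ZMod n, i.val % 2 = p ∧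
        (e = s((false, i), (true, i)) ∨ e = s((true, i), (false, i + 2)))} := by
  have : NeZero n := ⟨by omega⟩
  have hpar : ∀ t, ((p + 2 * t : ℕ) : ZMod n).val % 2 = p := fun t => by
    rw [ZMod.val_natCast_mod_two heven]
    omega
  obtain ⟨C, hC, hs, he⟩ := (Gn n).exists_isCycle_of_adj_succ (zigzag n p) hn
    (adj_zigzag p) (zigzag_self heven p) (fun i hi j hj => zigzag_inj hi hj)
  refine ⟨C, hC, fun x => ?_, Set.ext fun e => ?_⟩
  · rw [hs]
    constructor
    · rintro ⟨k, -, rfl⟩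
      exact hpar _
    · intro hx
      obtain ⟨b, i⟩ := x
      obtain ⟨t, ht, rfl⟩ := exists_eq_natCast_add_two_mul heven hp i hx
      cases b
      · exact ⟨2 * t, by omega, zigzag_two_mul p t⟩
      · exact ⟨2 * t + 1, ht, zigzag_two_mul_add_one p t⟩
  · rw [Set.mem_ofPred_eq, he, Set.mem_ofPred_eq]
    constructor
    · rintro ⟨k, -, rfl⟩
      obtain ⟨t, rfl | rfl⟩ := Nat.even_or_odd' k
      · exact ⟨_, hpar t, Or.inl (by rw [zigzag_two_mul, zigzag_two_mul_add_one])⟩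
      · exact ⟨_, hpar t, Or.inr (by rw [zigzag_two_mul_add_one, zigzag_two_mul_add_two])⟩
    · rintro ⟨i, hi, h⟩
      obtain ⟨t, ht, rfl⟩ := exists_eq_natCast_add_two_mul heven hp i hi
      rcases h with rfl | rfl
      · exact ⟨2 * t, by omega, by rw [zigzag_two_mul, zigzag_two_mul_add_one]⟩
      · exact ⟨2 * t + 1, ht, by rw [zigzag_two_mul_add_one, zigzag_two_mul_add_two]⟩

theorem isChordless_of_parity (hn : 2 ≤ n) (heven : Even n) {p : ℕ} {a : Bool × ZMod n}
    {C : (Gn n).Walk a a} (hs : ∀ x, x ∈ C.support ↔ x.2.val % 2 = p)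
    (he : {e | e ∈ C.edges} = {e | ∃ i : ZMod n, i.val % 2 = p ∧
      (e = s((false, i), (true, i)) ∨ e = s((true, i), (false, i + 2)))}) :
    IsChordless (Gn n) C := by
  have : NeZero n := ⟨by omega⟩
  rintro ⟨b, i⟩ ⟨c, j⟩ hadj hi hj
  have hi' : i.val % 2 = p := (hs _).1 hi
  have hj' : j.val % 2 = p := (hs _).1 hj
  have hsucc : ∀ k : ZMod n, (k + 1).val % 2 = (k.val + 1) % 2 := fun k => by
    simpa using ZMod.val_add_natCast_mod_two heven k 1
  have hsame : ∀ b, ¬ (Gn n).Adj (b, i) (b, j) := by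
    intro b h
    rcases (adj_same_iff hn b i j).1 h with rfl | rfl
    · have := hsucc i
      omega
    · have := hsucc j
      omega
  change _ ∈ {e | e ∈ C.edges}
  rw [he]
  cases b <;> cases c
  · exact absurd hadj (hsame _)
  · rcases (adj_false_true_iff i j).1 hadj with rfl | rfl
    · exact ⟨_, hj', Or.inl rfl⟩
    · exact ⟨_, hj', Or.inr Sym2.eq_swap⟩
  · rcases (adj_true_false_iff i j).1 hadj with rfl | rfl
    · exact ⟨_, hi', Or.inr rfl⟩
    · exact ⟨_, hi', Or.inl Sym2.eq_swap⟩
  · exact absurd hadj (hsame _)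

end Gn

/-- For every even `n ≥ 4`, the graph `G_n` is a connected `4`-regular (simple) graph
with `2n` vertices and `4n` edges, and the cycles `C_1, C_2, C_3, C_4` (given by their
edge sets) are chordless cycles of `G_n`, with `{C_1, C_2}` and `{C_3, C_4}` each a
covering pair of disjoint chordless cycles. -/
theorem Gn_structure (n : ℕ) (hn : 4 ≤ n) (heven : Even n) :
    (Gn n).Connected ∧
    (∀ w : Bool × ZMod n, ((Gn n).neighborSet w).ncard = 4) ∧
    Nat.card (Bool × ZMod n) = 2 * n ∧
    ((Gn n).edgeSet).ncard = 4 * n ∧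
    (∃ (a b : Bool × ZMod n) (C₁ : (Gn n).Walk a a) (C₂ : (Gn n).Walk b b),
      C₁.IsCycle ∧ C₂.IsCycle ∧
      {e | e ∈ C₁.edges} = edges1 n ∧ {e | e ∈ C₂.edges} = edges2 n ∧
      IsChordless (Gn n) C₁ ∧ IsChordless (Gn n) C₂ ∧
      WalkDisjoint C₁ C₂ ∧ CoveringPair C₁ C₂) ∧
    (∃ (a b : Bool × ZMod n) (C₃ : (Gn n).Walk a a) (C₄ : (Gn n).Walk b b),
      C₃.IsCycle ∧ C₄.IsCycle ∧
      {e | e ∈ C₃.edges} = edges3 n ∧ {e | e ∈ C₄.edges} = edges4 n ∧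
      IsChordless (Gn n) C₃ ∧ IsChordless (Gn n) C₄ ∧
      WalkDisjoint C₃ C₄ ∧ CoveringPair C₃ C₄) := by
  have : NeZero n := ⟨by omega⟩
  refine ⟨Gn.connected (by omega), Gn.ncard_neighborSet (by omega), ?_,
    Gn.ncard_edgeSet (by omega), ?_, ?_⟩
  · simp
  · obtain ⟨C₁, hC₁, hs₁, he₁⟩ := Gn.exists_layer_cycle (n := n) (by omega) false
    obtain ⟨C₂, hC₂, hs₂, he₂⟩ := Gn.exists_layer_cycle (n := n) (by omega) true
    refine ⟨_, _, C₁, C₂, hC₁, hC₂, he₁, he₂, Gn.isChordless_of_layer (by omega) hs₁ he₁,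
      Gn.isChordless_of_layer (by omega) hs₂ he₂, fun x hx => ?_, fun x => ?_⟩
    · rw [hs₁] at hx
      simp [hs₂, hx]
    · rw [hs₁, hs₂]
      cases x.1 <;> simp
  · obtain ⟨C₃, hC₃, hs₃, he₃⟩ :=
      Gn.exists_parity_cycle (by omega) heven (show 1 < 2 by omega)
    obtain ⟨C₄, hC₄, hs₄, he₄⟩ :=
      Gn.exists_parity_cycle (by omega) heven (show 0 < 2 by omega)
    refine ⟨_, _, C₃, C₄, hC₃, hC₄, ?_, ?_, Gn.isChordless_of_parity (by omega) heven hs₃ he₃,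
      Gn.isChordless_of_parity (by omega) heven hs₄ he₄, fun x hx => ?_, fun x => ?_⟩
    · simp only [he₃, edges3, Nat.odd_iff]
    · simp only [he₄, edges4, Nat.even_iff]
    · rw [hs₃] at hx
      simp [hs₄, hx]
    · rw [hs₃, hs₄]
      omega
end
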